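/- Let y : [0,U] → ℝ^ϖ be differentiable and satisfy ẏ_u = μ̂_u(y_u) − y_u for every u ∈ [0,U], where μ̂_u is the posterior mean formed with variance σ̃_u². Assume that for every u ∈ [0,U] the point y_u satisfies two-mode dominance for (i,j) with margin parameter κ > 0 (with variance σ̃_u²). Set ε := (N−2) · (max_{k∉{i,j}} ‖μ^(k) − μ^(i)‖) · ((max_{k∉{i,j}} π_k)/min(π_i, π_j)) · exp(−κ), and let w_u := (y_u − μ^(i)) − ⟨y_u − μ^(i), v⟩ v. If ‖w_{u₀}‖ ≤ ε for some u₀ ∈ [0,U], then ‖w_u‖ ≤ ε for all u ∈ [u₀, U]. -/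

import Mathlib

open Set
open scoped InnerProductSpace

/-- Responsibility of mode `k` at `y`, with variance parameter `σ̃²`. -/
noncomputable def resp {ϖ N : ℕ} (μ : Fin N → EuclideanSpace ℝ (Fin ϖ))
    (π : Fin N → ℝ) (σ : ℝ) (k : Fin N) (y : EuclideanSpace ℝ (Fin ϖ)) : ℝ :=
  π k * Real.exp (-‖y - μ k‖ ^ 2 / (2 * σ ^ 2)) /
    ∑ m : Fin N, π m * Real.exp (-‖y - μ m‖ ^ 2 / (2 * σ ^ 2))

/-- Posterior mean `μ̂(y) = ∑ₖ γₖ(y) μ⁽ᵏ⁾`. -/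
noncomputable def postMean {ϖ N : ℕ} (μ : Fin N → EuclideanSpace ℝ (Fin ϖ))
    (π : Fin N → ℝ) (σ : ℝ) (y : EuclideanSpace ℝ (Fin ϖ)) : EuclideanSpace ℝ (Fin ϖ) :=
  ∑ k : Fin N, resp μ π σ k y • μ k

/-- Two-mode dominance for the pair `(i,j)` with margin parameter `κ` and variance `σ̃²`. -/
def TwoModeDominance {ϖ N : ℕ} (μ : Fin N → EuclideanSpace ℝ (Fin ϖ))
    (σ : ℝ) (i j : Fin N) (κ : ℝ) (y : EuclideanSpace ℝ (Fin ϖ)) : Prop :=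
  ∀ k : Fin N, k ≠ i → k ≠ j →
    ‖y - μ k‖ ^ 2 ≥ min (‖y - μ i‖ ^ 2) (‖y - μ j‖ ^ 2) + 2 * σ ^ 2 * κ

/-- The denominator of the responsibilities dominates each of its terms. -/
lemma resp_le_div_mul_exp {ϖ N : ℕ} (μ : Fin N → EuclideanSpace ℝ (Fin ϖ)) {π : Fin N → ℝ}
    (hπpos : ∀ k, 0 < π k) (σ : ℝ) (k m : Fin N) (y : EuclideanSpace ℝ (Fin ϖ)) :
    resp μ π σ k y ≤
      π k / π m * Real.exp (-(‖y - μ k‖ ^ 2 - ‖y - μ m‖ ^ 2) / (2 * σ ^ 2)) := by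
  have hm : 0 < π m * Real.exp (-‖y - μ m‖ ^ 2 / (2 * σ ^ 2)) :=
    mul_pos (hπpos m) (Real.exp_pos _)
  have hle : π m * Real.exp (-‖y - μ m‖ ^ 2 / (2 * σ ^ 2)) ≤
      ∑ l : Fin N, π l * Real.exp (-‖y - μ l‖ ^ 2 / (2 * σ ^ 2)) :=
    Finset.single_le_sum (f := fun l => π l * Real.exp (-‖y - μ l‖ ^ 2 / (2 * σ ^ 2)))
      (fun l _ => (mul_pos (hπpos l) (Real.exp_pos _)).le) (Finset.mem_univ m)
  have hk : 0 ≤ π k * Real.exp (-‖y - μ k‖ ^ 2 / (2 * σ ^ 2)) :=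
    (mul_pos (hπpos k) (Real.exp_pos _)).le
  calc resp μ π σ k y
      ≤ π k * Real.exp (-‖y - μ k‖ ^ 2 / (2 * σ ^ 2)) /
          (π m * Real.exp (-‖y - μ m‖ ^ 2 / (2 * σ ^ 2))) :=
        div_le_div_of_nonneg_left hk hm hle
    _ = π k / π m * Real.exp (-(‖y - μ k‖ ^ 2 - ‖y - μ m‖ ^ 2) / (2 * σ ^ 2)) := by
        rw [mul_div_mul_comm, ← Real.exp_sub]
        congr 2
        ring

lemma resp_nonneg {ϖ N : ℕ} (μ : Fin N → EuclideanSpace ℝ (Fin ϖ)) {π : Fin N → ℝ}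
    (hπpos : ∀ k, 0 < π k) (σ : ℝ) (k : Fin N) (y : EuclideanSpace ℝ (Fin ϖ)) :
    0 ≤ resp μ π σ k y :=
  div_nonneg (mul_pos (hπpos k) (Real.exp_pos _)).le
    (Finset.sum_nonneg fun l _ => (mul_pos (hπpos l) (Real.exp_pos _)).le)

lemma sum_resp_eq_one {ϖ N : ℕ} (μ : Fin N → EuclideanSpace ℝ (Fin ϖ)) {π : Fin N → ℝ}
    (hπpos : ∀ k, 0 < π k) (σ : ℝ) (i : Fin N) (y : EuclideanSpace ℝ (Fin ϖ)) :
    ∑ k, resp μ π σ k y = 1 := by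
  unfold resp
  rw [← Finset.sum_div]
  exact div_self
    (Finset.sum_pos (fun l _ => mul_pos (hπpos l) (Real.exp_pos _)) ⟨i, Finset.mem_univ i⟩).ne'

/-- Under two-mode dominance, the responsibilities of the other modes are exponentially small. -/
lemma TwoModeDominance.resp_le {ϖ N : ℕ} {μ : Fin N → EuclideanSpace ℝ (Fin ϖ)} {π : Fin N → ℝ}
    (hπpos : ∀ k, 0 < π k) {σ : ℝ} (hσ : 0 < σ) {i j : Fin N} {κ : ℝ}
    {y : EuclideanSpace ℝ (Fin ϖ)} (h : TwoModeDominance μ σ i j κ y) {k : Fin N}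
    (hki : k ≠ i) (hkj : k ≠ j) :
    resp μ π σ k y ≤ π k / min (π i) (π j) * Real.exp (-κ) := by
  have hmin : 0 < min (π i) (π j) := lt_min (hπpos i) (hπpos j)
  obtain ⟨m, hm, hd⟩ : ∃ m, min (π i) (π j) ≤ π m ∧
      ‖y - μ k‖ ^ 2 ≥ ‖y - μ m‖ ^ 2 + 2 * σ ^ 2 * κ := by
    have hk := h k hki hkj
    rcases min_choice (‖y - μ i‖ ^ 2) (‖y - μ j‖ ^ 2) with e | e <;> rw [e] at hk
    · exact ⟨i, min_le_left _ _, hk⟩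
    · exact ⟨j, min_le_right _ _, hk⟩
  refine (resp_le_div_mul_exp μ hπpos σ k m y).trans ?_
  have hexp : -(‖y - μ k‖ ^ 2 - ‖y - μ m‖ ^ 2) / (2 * σ ^ 2) ≤ -κ := by
    rw [div_le_iff₀ (by positivity)]
    linarith
  have := (hπpos k).le
  gcongr

/-- A contraction killing `μ j - μ i` maps the posterior mean, recentred at `μ i`, to a vector
which is exponentially small under two-mode dominance. -/
lemma TwoModeDominance.norm_apply_postMean_sub_le {ϖ N : ℕ}
    {μ : Fin N → EuclideanSpace ℝ (Fin ϖ)} {π : Fin N → ℝ}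
    (hπpos : ∀ k, 0 < π k) {σ : ℝ} (hσ : 0 < σ) {i j : Fin N} (hij : i ≠ j) {κ : ℝ}
    {y : EuclideanSpace ℝ (Fin ϖ)} (h : TwoModeDominance μ σ i j κ y)
    (P : EuclideanSpace ℝ (Fin ϖ) →L[ℝ] EuclideanSpace ℝ (Fin ϖ))
    (hP : ∀ x, ‖P x‖ ≤ ‖x‖) (hPv : P (μ j - μ i) = 0) :
    ‖P (postMean μ π σ y - μ i)‖ ≤
      (N - 2 : ℝ) * (⨆ k : {k : Fin N // k ≠ i ∧ k ≠ j}, ‖μ k.1 - μ i‖) *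
      ((⨆ k : {k : Fin N // k ≠ i ∧ k ≠ j}, π k.1) / min (π i) (π j)) * Real.exp (-κ) := by
  set D := ⨆ k : {k : Fin N // k ≠ i ∧ k ≠ j}, ‖μ k.1 - μ i‖
  set M := ⨆ k : {k : Fin N // k ≠ i ∧ k ≠ j}, π k.1
  have hmin : 0 < min (π i) (π j) := lt_min (hπpos i) (hπpos j)
  have hsum : P (postMean μ π σ y - μ i) = ∑ k, resp μ π σ k y • P (μ k - μ i) := by
    have : postMean μ π σ y - μ i = ∑ k, resp μ π σ k y • (μ k - μ i) := by
      simp only [smul_sub, Finset.sum_sub_distrib, ← Finset.sum_smul,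
        sum_resp_eq_one μ hπpos σ i y, one_smul]
      rfl
    simp only [this, map_sum, map_smul]
  have hrest : ∑ k ∈ ({i, j} : Finset (Fin N))ᶜ, resp μ π σ k y • P (μ k - μ i) =
      ∑ k, resp μ π σ k y • P (μ k - μ i) := by
    refine Finset.sum_subset (Finset.subset_univ _) fun k _ hk => ?_
    simp only [Finset.mem_compl, Finset.mem_insert, Finset.mem_singleton, not_not] at hk
    rcases hk with rfl | rfl
    · simp
    · simp [hPv]
  have hcard : ((({i, j} : Finset (Fin N))ᶜ.card : ℕ) : ℝ) = N - 2 := by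
    have := Finset.card_add_card_compl ({i, j} : Finset (Fin N))
    rw [Finset.card_pair hij, Fintype.card_fin] at this
    rw [eq_sub_iff_add_eq']
    exact_mod_cast this
  have hterm : ∀ k ∈ ({i, j} : Finset (Fin N))ᶜ,
      ‖resp μ π σ k y • P (μ k - μ i)‖ ≤ M / min (π i) (π j) * Real.exp (-κ) * D := by
    intro k hk
    simp only [Finset.mem_compl, Finset.mem_insert, Finset.mem_singleton, not_or] at hk
    have hD : ‖μ k - μ i‖ ≤ D :=
      le_ciSup (f := fun k : {k : Fin N // k ≠ i ∧ k ≠ j} => ‖μ k.1 - μ i‖)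
        (Set.finite_range _).bddAbove ⟨k, hk⟩
    have hM : π k ≤ M :=
      le_ciSup (f := fun k : {k : Fin N // k ≠ i ∧ k ≠ j} => π k.1)
        (Set.finite_range _).bddAbove ⟨k, hk⟩
    have hM0 : 0 ≤ M := (hπpos k).le.trans hM
    rw [norm_smul, Real.norm_of_nonneg (resp_nonneg μ hπpos σ k y)]
    refine mul_le_mul ((h.resp_le hπpos hσ hk.1 hk.2).trans ?_) ((hP _).trans hD)
      (norm_nonneg _) (by positivity)
    gcongr
  calc ‖P (postMean μ π σ y - μ i)‖
      ≤ ∑ k ∈ ({i, j} : Finset (Fin N))ᶜ, M / min (π i) (π j) * Real.exp (-κ) * D := by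
        rw [hsum, ← hrest]
        exact norm_sum_le_of_le _ hterm
    _ = (N - 2 : ℝ) * D * (M / min (π i) (π j)) * Real.exp (-κ) := by
        rw [Finset.sum_const, nsmul_eq_mul, hcard]
        ring

/-- A ball of radius `ε` is forward invariant under `w' = r - w` when `‖r‖ ≤ ε`. -/
lemma norm_le_of_hasDerivAt_sub_self {E : Type*} [NormedAddCommGroup E] [NormedSpace ℝ E]
    {w r : ℝ → E} {a b ε : ℝ} (hw : ∀ u ∈ Icc a b, HasDerivAt w (r u - w u) u)
    (hr : ∀ u ∈ Icc a b, ‖r u‖ ≤ ε) (ha : ‖w a‖ ≤ ε) : ∀ u ∈ Icc a b, ‖w u‖ ≤ ε := by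
  have hg : ∀ u ∈ Icc a b, HasDerivAt (fun t => Real.exp t • w t) (Real.exp u • r u) u := by
    intro u hu
    refine ((Real.hasDerivAt_exp u).smul (hw u hu)).congr_deriv ?_
    rw [smul_sub, sub_add_cancel]
  have hn : ∀ u (x : E), ‖Real.exp u • x‖ = Real.exp u * ‖x‖ := fun u x => by
    rw [norm_smul, Real.norm_of_nonneg (Real.exp_pos u).le]
  intro u hu
  have key := image_norm_le_of_norm_deriv_right_le_deriv_boundary
    (f := fun t => Real.exp t • w t) (f' := fun t => Real.exp t • r t)
    (B := fun t => Real.exp t * ε) (B' := fun t => Real.exp t * ε)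
    (fun t ht => (hg t ht).continuousAt.continuousWithinAt)
    (fun t ht => (hg t (Ico_subset_Icc_self ht)).hasDerivWithinAt)
    (by rw [hn]; gcongr) (fun t => (Real.hasDerivAt_exp t).mul_const ε)
    (fun t ht => by
      rw [hn]
      have := hr t (Ico_subset_Icc_self ht)
      gcongr) hu
  rw [hn] at key
  exact le_of_mul_le_mul_left key (Real.exp_pos u)

/-- Trapping of the orthogonal component: once the orthogonal component of a
solution of `ẏᵤ = μ̂ᵤ(yᵤ) − yᵤ` has norm at most `ε`, it stays so. -/
theorem orthogonal_component_trapping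
    (ϖ N : ℕ) (hϖ : 1 ≤ ϖ) (hN : 2 ≤ N)
    (μ : Fin N → EuclideanSpace ℝ (Fin ϖ)) (π : Fin N → ℝ)
    (hπpos : ∀ k, 0 < π k) (hπsum : ∑ k : Fin N, π k = 1)
    (i j : Fin N) (hij : i ≠ j) (hμ : μ i ≠ μ j)
    (v : EuclideanSpace ℝ (Fin ϖ)) (hv : v = ‖μ j - μ i‖⁻¹ • (μ j - μ i))
    (U : ℝ) (hU : 0 ≤ U)
    (σt : ℝ → ℝ) (hσt : ∀ u ∈ Icc (0 : ℝ) U, 0 < σt u)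
    (κ : ℝ) (hκ : 0 < κ)
    (y : ℝ → EuclideanSpace ℝ (Fin ϖ))
    (hy : ∀ u ∈ Icc (0 : ℝ) U, HasDerivAt y (postMean μ π (σt u) (y u) - y u) u)
    (hdom : ∀ u ∈ Icc (0 : ℝ) U, TwoModeDominance μ (σt u) i j κ (y u))
    (ε : ℝ)
    (hε : ε = (N - 2 : ℝ) * (⨆ k : {k : Fin N // k ≠ i ∧ k ≠ j}, ‖μ k.1 - μ i‖) *
      ((⨆ k : {k : Fin N // k ≠ i ∧ k ≠ j}, π k.1) / min (π i) (π j)) * Real.exp (-κ))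
    (w : ℝ → EuclideanSpace ℝ (Fin ϖ))
    (hw : ∀ u, w u = (y u - μ i) - ⟪y u - μ i, v⟫_ℝ • v)
    (u₀ : ℝ) (hu₀ : u₀ ∈ Icc (0 : ℝ) U) (hw0 : ‖w u₀‖ ≤ ε) :
    ∀ u ∈ Icc u₀ U, ‖w u‖ ≤ ε := by
  set P : EuclideanSpace ℝ (Fin ϖ) →L[ℝ] EuclideanSpace ℝ (Fin ϖ) :=
    (ℝ ∙ v)ᗮ.starProjection
  have hne : ‖μ j - μ i‖ ≠ 0 := norm_ne_zero_iff.mpr (sub_ne_zero.mpr hμ.symm)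
  have hv1 : ‖v‖ = 1 := by
    rw [hv, norm_smul, norm_inv, norm_norm, inv_mul_cancel₀ hne]
  have hPapply : ∀ x, P x = x - ⟪x, v⟫_ℝ • v := fun x => by
    rw [real_inner_comm, ← Submodule.starProjection_unit_singleton ℝ hv1 x,
      Submodule.starProjection_orthogonal_val]
  have hPnorm : ∀ x, ‖P x‖ ≤ ‖x‖ := Submodule.norm_starProjection_apply_le _
  have hPv : P (μ j - μ i) = 0 := by
    have hμv : μ j - μ i = ‖μ j - μ i‖ • v := by rw [hv, smul_inv_smul₀ hne]
    rw [hμv, map_smul, hPapply, real_inner_self_eq_norm_sq, hv1]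
    simp
  have hwP : w = fun u => P (y u - μ i) := funext fun u => by rw [hw, hPapply]
  have hsub : Icc u₀ U ⊆ Icc 0 U := Icc_subset_Icc_left hu₀.1
  refine norm_le_of_hasDerivAt_sub_self
    (r := fun u => P (postMean μ π (σt u) (y u) - μ i)) (fun u hu => ?_) (fun u hu => ?_) hw0
  · rw [hwP]
    refine (P.hasFDerivAt.comp_hasDerivAt u ((hy u (hsub hu)).sub_const (μ i))).congr_deriv ?_
    rw [← map_sub, sub_sub_sub_cancel_right]
  · rw [hε]
    exact (hdom u (hsub hu)).norm_apply_postMean_sub_le hπpos (hσt u (hsub hu)) hij P hPnorm hPv
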